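/- For all integers n ≥ 2 and k ≥ 1 such that (k : ℝ) ≤ n / (56 · logb 2 n), there exists a Markovian avoidance coupling of k walkers on the (loopless) complete graph K_n (here logb 2 n denotes the real logarithm of n in base 2). -/

import Mathlib

open MeasureTheory ProbabilityTheory

/-- `X` is a faithful simple random walk on the loopless complete graph `K_n`:
at each step the walker moves to a uniformly random vertex other than its
current one. -/
def IsWalkLoopless {Ω : Type} [MeasurableSpace Ω] (μ : Measure Ω) {n : ℕ}
    (X : ℕ → Ω → Fin n) : Prop :=
  ∀ (t : ℕ) (v : ℕ → Fin n),
    μ {ω | ∀ s ≤ t + 1, X s ω = v s} =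
      μ {ω | ∀ s ≤ t, X s ω = v s} *
        (if v (t + 1) = v t then 0 else ((n - 1 : ℕ) : ENNReal)⁻¹)

/-- `X` is a faithful simple random walk on the looped complete graph `K_n^*`:
at each step the walker moves to a uniformly random vertex (possibly its
current one). -/
def IsWalkLooped {Ω : Type} [MeasurableSpace Ω] (μ : Measure Ω) {n : ℕ}
    (X : ℕ → Ω → Fin n) : Prop :=
  ∀ (t : ℕ) (v : ℕ → Fin n),
    μ {ω | ∀ s ≤ t + 1, X s ω = v s} =
      μ {ω | ∀ s ≤ t, X s ω = v s} * ((n : ℕ) : ENNReal)⁻¹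

/-- The `k` walkers `X 0, …, X (k-1)`, moving in turn in cyclic order, almost
surely never collide: initially their positions are pairwise distinct, and
whenever a walker moves it never lands on the current position of another
walker (walkers `i < j` having already made their move number `t+1`, walkers
`i > j` still sitting at their position at time `t`). -/
def AvoidsAE {Ω : Type} [MeasurableSpace Ω] (μ : Measure Ω) {n k : ℕ}
    (X : Fin k → ℕ → Ω → Fin n) : Prop :=
  ∀ᵐ ω ∂μ,
    (∀ i j : Fin k, i ≠ j → X i 0 ω ≠ X j 0 ω) ∧
    (∀ (t : ℕ) (i j : Fin k),
      (i < j → X j (t + 1) ω ≠ X i (t + 1) ω) ∧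
      (j < i → X j (t + 1) ω ≠ X i t ω))

/-- The coupling is Markovian: there are transition rules `f j` so that for
every walker `j` and time `t`, conditionally on the whole history (all
positions up to time `t`, together with the moves at time `t+1` of the walkers
`i < j` preceding `j` in the current round), the next position `X j (t+1)` is
distributed according to `f j` applied to the current configuration. -/
def IsMarkovianCoupling {Ω : Type} [MeasurableSpace Ω] (μ : Measure Ω) {n k : ℕ}
    (X : Fin k → ℕ → Ω → Fin n) : Prop :=
  ∃ f : Fin k → (Fin k → Fin n) → PMF (Fin n),
    ∀ (t : ℕ) (j : Fin k) (v : Fin k → ℕ → Fin n) (w : Fin n),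
      μ {ω | ((∀ i : Fin k, ∀ s ≤ t, X i s ω = v i s) ∧
              (∀ i < j, X i (t + 1) ω = v i (t + 1))) ∧ X j (t + 1) ω = w} =
        μ {ω | (∀ i : Fin k, ∀ s ≤ t, X i s ω = v i s) ∧
               (∀ i < j, X i (t + 1) ω = v i (t + 1))} *
          f j (fun i => if i < j then v i (t + 1) else v i t) w

/-- There is an avoidance coupling of `k` walkers on the loopless complete
graph `K_n`. -/
def AvoidanceCouplingLoopless (n k : ℕ) : Prop :=
  ∃ (Ω : Type) (_ : MeasurableSpace Ω) (μ : Measure Ω)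
    (X : Fin k → ℕ → Ω → Fin n),
      IsProbabilityMeasure μ ∧ (∀ j t, Measurable (X j t)) ∧
      (∀ j, IsWalkLoopless μ (X j)) ∧ AvoidsAE μ X

/-- There is an avoidance coupling of `k` walkers on the looped complete
graph `K_n^*`. -/
def AvoidanceCouplingLooped (n k : ℕ) : Prop :=
  ∃ (Ω : Type) (_ : MeasurableSpace Ω) (μ : Measure Ω)
    (X : Fin k → ℕ → Ω → Fin n),
      IsProbabilityMeasure μ ∧ (∀ j t, Measurable (X j t)) ∧
      (∀ j, IsWalkLooped μ (X j)) ∧ AvoidsAE μ X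

/-- There is a Markovian avoidance coupling of `k` walkers on `K_n`. -/
def MarkovianAvoidanceCouplingLoopless (n k : ℕ) : Prop :=
  ∃ (Ω : Type) (_ : MeasurableSpace Ω) (μ : Measure Ω)
    (X : Fin k → ℕ → Ω → Fin n),
      IsProbabilityMeasure μ ∧ (∀ j t, Measurable (X j t)) ∧
      (∀ j, IsWalkLoopless μ (X j)) ∧ AvoidsAE μ X ∧ IsMarkovianCoupling μ X

/-- There is a Markovian avoidance coupling of `k` walkers on `K_n^*`. -/
def MarkovianAvoidanceCouplingLooped (n k : ℕ) : Prop :=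
  ∃ (Ω : Type) (_ : MeasurableSpace Ω) (μ : Measure Ω)
    (X : Fin k → ℕ → Ω → Fin n),
      IsProbabilityMeasure μ ∧ (∀ j t, Measurable (X j t)) ∧
      (∀ j, IsWalkLooped μ (X j)) ∧ AvoidsAE μ X ∧ IsMarkovianCoupling μ X

open scoped Classical in
/-- Weight of the paths satisfying the constraints `A 0, …, A t` and ending at `z`. -/
noncomputable def chainWeight {C : Type} [Fintype C] (p : PMF C) (P : C → PMF C)
    (A : ℕ → C → Prop) : ℕ → C → ENNReal
  | 0, z => if A 0 z then p z else 0
  | t + 1, z' => if A (t + 1) z' then ∑ z, chainWeight p P A t z * P z z' else 0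

/-- The chain driven by random maps. -/
def chainProc {C : Type} (c0 : C) : ℕ → (ℕ → C → C) → C
  | 0, w => w 0 c0
  | t + 1, w => w (t + 1) (chainProc c0 t w)

lemma chainProc_congr {C : Type} (c0 : C) (t : ℕ) (w w' : ℕ → C → C)
    (h : ∀ s ≤ t, w s = w' s) : chainProc c0 t w = chainProc c0 t w' := by
  induction t with
  | zero => simp [chainProc, h 0 le_rfl]
  | succ t ih =>
    simp only [chainProc]
    rw [ih (fun s hs => h s (by omega)), h (t + 1) le_rfl]

/-- The law of the driving maps. -/
noncomputable def chainStep {C : Type} [Fintype C] [MeasurableSpace C]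
    (p : PMF C) (P : C → PMF C) : ℕ → Measure (C → C)
  | 0 => Measure.pi (fun _ => p.toMeasure)
  | _ + 1 => Measure.pi (fun c => (P c).toMeasure)

instance chainStep_prob {C : Type} [Fintype C] [MeasurableSpace C]
    (p : PMF C) (P : C → PMF C) (t : ℕ) : IsProbabilityMeasure (chainStep p P t) := by
  cases t <;> simp only [chainStep] <;> infer_instance

lemma pi_eval_singleton {C : Type} [Fintype C] [MeasurableSpace C]
    [MeasurableSingletonClass C] (P : C → PMF C) (c z : C) :
    Measure.pi (fun c => (P c).toMeasure) {u : C → C | u c = z} = P c z := by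
  have h := (measurePreserving_eval (fun c => (P c).toMeasure) c).measure_preimage
    (s := {z}) (MeasurableSet.singleton z).nullMeasurableSet
  rw [PMF.toMeasure_apply_singleton _ _ (MeasurableSet.singleton z)] at h
  exact h

lemma chainProc_measurable {C : Type} [Fintype C] [MeasurableSpace C]
    [MeasurableSingletonClass C] (c0 : C) (t : ℕ) : Measurable (chainProc c0 t) := by
  induction t with
  | zero =>
    have : chainProc c0 0 = fun w : ℕ → C → C => w 0 c0 := by funext w; rfl
    rw [this]; fun_prop
  | succ t ih =>
    have h1 : Measurable (fun q : (C → C) × C => q.1 q.2) := measurable_of_countable _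
    have h2 : Measurable (fun w : ℕ → C → C => (w (t + 1), chainProc c0 t w)) :=
      (measurable_pi_apply (t + 1)).prodMk ih
    exact h1.comp h2

lemma chain_eval_measure {C : Type} [Fintype C] [MeasurableSpace C]
    [MeasurableSingletonClass C] (p : PMF C) (P : C → PMF C) (t : ℕ) (B : Set (C → C)) :
    Measure.infinitePi (chainStep p P) {w | w t ∈ B} = chainStep p P t B := by
  have h := (measurePreserving_eval_infinitePi (chainStep p P) t).measure_preimage
    (s := B) (MeasurableSet.of_discrete).nullMeasurableSet
  exact h

lemma chain_indep {C : Type} [Fintype C] [MeasurableSpace C]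
    [MeasurableSingletonClass C] (p : PMF C) (P : C → PMF C) (t : ℕ)
    (E : Set (ℕ → C → C)) (hE : ∀ w w' : ℕ → C → C, (∀ s ≤ t, w s = w' s) → (w ∈ E ↔ w' ∈ E))
    (B : Set (C → C)) :
    Measure.infinitePi (chainStep p P) (E ∩ {w | w (t + 1) ∈ B}) =
      Measure.infinitePi (chainStep p P) E * chainStep p P (t + 1) B := by
  have hi : iIndepFun (fun (i : ℕ) (w : ℕ → C → C) => w i)
      (Measure.infinitePi (chainStep p P)) :=
    iIndepFun_infinitePi (P := chainStep p P) (X := fun _ => id) (fun _ => measurable_id)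
  have h2 := hi.indepFun_finset (Finset.Iic t) {t + 1} (by simp) (fun i => measurable_pi_apply i)
  have h3 := h2.measure_inter_preimage_eq_mul
    {r | ∃ w ∈ E, (fun i : Finset.Iic t => w i) = r}
    {r | r ⟨t + 1, by simp⟩ ∈ B} MeasurableSet.of_discrete MeasurableSet.of_discrete
  have e1 : (fun (a : ℕ → C → C) (i : Finset.Iic t) => a i) ⁻¹'
      {r | ∃ w ∈ E, (fun i : Finset.Iic t => w i) = r} = E := by
    ext w
    simp only [Set.mem_preimage, Set.mem_ofPred_eq]
    constructor
    · rintro ⟨w', hw', he⟩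
      refine (hE w' w fun s hs => ?_).1 hw'
      exact congrFun he ⟨s, by simpa using hs⟩
    · intro hw
      exact ⟨w, hw, rfl⟩
  rw [e1] at h3
  rw [← chain_eval_measure p P (t + 1) B]
  exact h3

lemma measure_eq_sum {Ω C : Type} [Fintype C] [MeasurableSpace Ω] [MeasurableSpace C]
    [MeasurableSingletonClass C] (μ : Measure Ω) (Z : Ω → C) (hZ : Measurable Z) (E : Set Ω) :
    μ E = ∑ z, μ (E ∩ {w | Z w = z}) := by
  have h := sum_measure_preimage_singleton (μ := μ.restrict E) (Finset.univ : Finset C)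
    (f := Z) (fun y _ => hZ (MeasurableSet.singleton y))
  simp only [Finset.coe_univ, Set.preimage_univ, Measure.restrict_apply_univ] at h
  rw [← h]
  refine Finset.sum_congr rfl fun z _ => ?_
  rw [Measure.restrict_apply (hZ (MeasurableSet.singleton z)), Set.inter_comm]
  rfl

lemma chain_weight_eq {C : Type} [Fintype C] [MeasurableSpace C]
    [MeasurableSingletonClass C] (p : PMF C) (P : C → PMF C) (c0 : C) (A : ℕ → C → Prop)
    (t : ℕ) (z : C) :
    Measure.infinitePi (chainStep p P)
      ({w | ∀ s ≤ t, A s (chainProc c0 s w)} ∩ {w | chainProc c0 t w = z}) =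
      chainWeight p P A t z := by
  induction t generalizing z with
  | zero =>
    simp only [chainWeight]
    split_ifs with h
    · rw [← pi_eval_singleton (fun _ => p) c0 z]
      rw [show Measure.pi (fun _ : C => p.toMeasure) = chainStep p P 0 from rfl,
        ← chain_eval_measure]
      congr 1
      ext w
      simp only [Set.mem_inter_iff, Set.mem_ofPred_eq, Nat.le_zero, forall_eq, chainProc]
      constructor
      · exact fun h => h.2
      · intro h'; rw [h']; exact ⟨h, rfl⟩
    · convert measure_empty (μ := Measure.infinitePi (chainStep p P))
      ext w
      simp only [Set.mem_inter_iff, Set.mem_ofPred_eq, Nat.le_zero, forall_eq,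
        Set.mem_empty_iff_false, iff_false, not_and]
      rintro h1 rfl
      exact h h1
  | succ t ih =>
    simp only [chainWeight]
    split_ifs with h
    · rw [measure_eq_sum _ (chainProc c0 t) (chainProc_measurable c0 t)]
      refine Finset.sum_congr rfl fun y _ => ?_
      rw [← ih y, ← pi_eval_singleton P y z]
      rw [show Measure.pi (fun c : C => (P c).toMeasure) = chainStep p P (t + 1) from rfl,
        ← chain_indep]
      · congr 1
        ext w
        simp only [Set.mem_inter_iff, Set.mem_ofPred_eq, chainProc]
        constructor
        · rintro ⟨⟨h1, h2⟩, h3⟩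
          rw [h3] at h2
          exact ⟨⟨fun s hs => h1 s (by omega), h3⟩, h2⟩
        · rintro ⟨⟨h1, h3⟩, h2⟩
          refine ⟨⟨fun s hs => ?_, by rw [h3]; exact h2⟩, h3⟩
          rcases Nat.lt_or_ge t s with h4 | h4
          · obtain rfl : s = t + 1 := by omega
            simp only [chainProc, h3, h2]
            exact h
          · exact h1 s h4
      · intro w w' hw
        have hh : ∀ s ≤ t, chainProc c0 s w = chainProc c0 s w' := fun s hs =>
          chainProc_congr c0 s w w' (fun r hr => hw r (by omega))
        simp only [Set.mem_inter_iff, Set.mem_ofPred_eq]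
        rw [hh t le_rfl]
        refine and_congr_left fun _ => forall_congr' fun s => imp_congr_right fun hs => ?_
        rw [hh s hs]
    · convert measure_empty (μ := Measure.infinitePi (chainStep p P))
      ext w
      simp only [Set.mem_inter_iff, Set.mem_ofPred_eq,
        Set.mem_empty_iff_false, iff_false, not_and]
      rintro h1 rfl
      exact h (h1 (t + 1) le_rfl)

lemma chain_exists {C : Type} [Fintype C] [MeasurableSpace C]
    [MeasurableSingletonClass C] (p : PMF C) (P : C → PMF C) :
    ∃ (Ω : Type) (_ : MeasurableSpace Ω) (μ : Measure Ω) (Z : ℕ → Ω → C),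
      IsProbabilityMeasure μ ∧ (∀ t, Measurable (Z t)) ∧
      ∀ (A : ℕ → C → Prop) (t : ℕ),
        μ {w | ∀ s ≤ t, A s (Z s w)} = ∑ z, chainWeight p P A t z := by
  obtain ⟨c0, _⟩ := p.support_nonempty
  refine ⟨ℕ → C → C, inferInstance, Measure.infinitePi (chainStep p P), chainProc c0,
    inferInstance, chainProc_measurable c0, fun A t => ?_⟩
  rw [measure_eq_sum _ (chainProc c0 t) (chainProc_measurable c0 t)]
  exact Finset.sum_congr rfl fun z _ => chain_weight_eq p P c0 A t z

lemma chainWeight_congr {C : Type} [Fintype C] (p : PMF C) (P : C → PMF C)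
    (A A' : ℕ → C → Prop) (t : ℕ) (h : ∀ s ≤ t, A s = A' s) (z : C) :
    chainWeight p P A t z = chainWeight p P A' t z := by
  induction t generalizing z with
  | zero =>
    simp only [chainWeight]
    congr 1
    rw [h 0 le_rfl]
  | succ t ih =>
    simp only [chainWeight]
    simp only [ih (fun s hs => h s (by omega))]
    congr 1
    rw [h (t + 1) le_rfl]

lemma chainWeight_sum_zero {C : Type} [Fintype C] (p : PMF C) (P : C → PMF C)
    (A : ℕ → C → Prop) [DecidablePred (A 0)] (g : C → ENNReal) :
    ∑ z, chainWeight p P A 0 z * g z = ∑ z, p z * ((if A 0 z then 1 else 0) * g z) := by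
  refine Finset.sum_congr rfl fun z _ => ?_
  by_cases h : A 0 z <;> simp [chainWeight, h]

lemma chainWeight_sum_succ {C : Type} [Fintype C] (p : PMF C) (P : C → PMF C)
    (A : ℕ → C → Prop) (t : ℕ) [DecidablePred (A (t + 1))] (g : C → ENNReal) :
    ∑ z, chainWeight p P A (t + 1) z * g z =
      ∑ z, chainWeight p P A t z *
        ∑ z', P z z' * ((if A (t + 1) z' then 1 else 0) * g z') := by
  simp_rw [Finset.mul_sum]
  rw [Finset.sum_comm]
  refine Finset.sum_congr rfl fun z' _ => ?_
  by_cases h : A (t + 1) z'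
  · simp only [chainWeight, h, if_true, one_mul, Finset.sum_mul, mul_assoc]
  · simp [chainWeight, h]

lemma chain_exists' {C : Type} [Fintype C] [MeasurableSpace C]
    [MeasurableSingletonClass C] (p : PMF C) (P : C → PMF C) :
    ∃ (Ω : Type) (_ : MeasurableSpace Ω) (μ : Measure Ω) (Z : ℕ → Ω → C),
      IsProbabilityMeasure μ ∧ (∀ t, Measurable (Z t)) ∧
      (∀ (A : ℕ → C → Prop) (t : ℕ),
        μ {w | ∀ s ≤ t, A s (Z s w)} = ∑ z, chainWeight p P A t z) ∧
      (∀ (A : ℕ → C → Prop) (t : ℕ) (B : C → Prop) [DecidablePred B],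
        μ {w | (∀ s ≤ t, A s (Z s w)) ∧ B (Z (t + 1) w)} =
          ∑ z, chainWeight p P A t z * ∑ z', P z z' * (if B z' then 1 else 0)) := by
  classical
  obtain ⟨Ω, m, μ, Z, h1, h2, h3⟩ := chain_exists p P
  refine ⟨Ω, m, μ, Z, h1, h2, h3, fun A t B _ => ?_⟩
  have h := h3 (fun s => if s ≤ t then A s else B) (t + 1)
  have h4 := chainWeight_sum_succ p P (fun s => if s ≤ t then A s else B) t (fun _ => 1)
  simp only [mul_one] at h4
  rw [h4] at h
  have e : {w | (∀ s ≤ t, A s (Z s w)) ∧ B (Z (t + 1) w)} =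
      {w | ∀ s ≤ t + 1, (if s ≤ t then A s else B) (Z s w)} := by
    ext w
    simp only [Set.mem_ofPred_eq]
    constructor
    · rintro ⟨ha, hb⟩ s hs
      by_cases hst : s ≤ t
      · simp only [hst, if_true]; exact ha s hst
      · obtain rfl : s = t + 1 := by omega
        simpa using hb
    · intro ha
      refine ⟨fun s hs => ?_, ?_⟩
      · have := ha s (by omega)
        simpa only [hs, if_true] using this
      · have := ha (t + 1) le_rfl
        simpa using this
  rw [e, h]
  refine Finset.sum_congr rfl fun z _ => ?_
  rw [chainWeight_congr p P _ A t (fun s hs => by simp [hs])]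
  congr 1
  refine Finset.sum_congr rfl fun z' _ => ?_
  simp

/-! ### Finite sums of product weights -/

lemma pmf_sum_one {V : Type} [Fintype V] (p : PMF V) : ∑ v, p v = 1 := by
  rw [← tsum_fintype (L := .unconditional _)]; exact p.tsum_coe

lemma sum_prod_fix {ι V : Type} [Fintype ι] [DecidableEq ι] [Fintype V] [DecidableEq V]
    (p : ι → PMF V) (J : ι → Prop) [DecidablePred J] (v : ι → V) :
    ∑ x : ι → V, (∏ i, p i (x i)) * (if ∀ i, J i → x i = v i then 1 else 0) =
      ∏ i, if J i then p i (v i) else 1 := by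
  have h : ∀ i, (if J i then p i (v i) else 1) =
      ∑ y, p i y * (if J i → y = v i then 1 else 0) := by
    intro i
    by_cases hi : J i
    · simp [hi]
    · simp [hi, pmf_sum_one]
  simp_rw [h]
  rw [Fintype.prod_sum]
  refine Finset.sum_congr rfl fun x _ => ?_
  rw [Finset.prod_mul_distrib]
  congr 1
  rw [Finset.prod_ite_zero]
  simp

lemma sum_prod_one {ι V : Type} [Fintype ι] [DecidableEq ι] [Fintype V]
    (p : ι → PMF V) : ∑ x : ι → V, (∏ i, p i (x i)) = 1 := by
  rw [← Fintype.prod_sum]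
  simp [pmf_sum_one]

lemma sum_replace {ι V : Type} [Fintype ι] [DecidableEq ι] [Fintype V] (v0 : V)
    (p p' : ι → PMF V) (J : ι → Prop) [DecidablePred J] (hp : ∀ i, J i → p i = p' i)
    (g : (ι → V) → ENNReal) (hg : ∀ x y, (∀ i, J i → x i = y i) → g x = g y) :
    ∑ x : ι → V, (∏ i, p i (x i)) * g x = ∑ x : ι → V, (∏ i, p' i (x i)) * g x := by
  have key : ∀ q : ι → PMF V, ∑ x : ι → V, (∏ i, q i (x i)) * g x =
      ∑ a : {i // J i} → V, ∑ b : {i // ¬ J i} → V,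
        (∏ i, q i.1 (a i)) * (∏ i, q i.1 (b i)) *
          g ((Equiv.piEquivPiSubtypeProd J (fun _ => V)).symm (a, b)) := by
    intro q
    rw [← Fintype.sum_prod_type']
    rw [← (Equiv.piEquivPiSubtypeProd J (fun _ => V)).symm.sum_comp]
    refine Finset.sum_congr rfl fun ab _ => ?_
    rw [← Fintype.prod_subtype_mul_prod_subtype J]
    congr 2
    · refine Finset.prod_congr rfl fun i _ => ?_
      simp [Equiv.piEquivPiSubtypeProd, i.2]
    · refine Finset.prod_congr rfl fun i _ => ?_
      simp [Equiv.piEquivPiSubtypeProd, i.2]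
  have key2 : ∀ q : ι → PMF V, ∀ a : {i // J i} → V, ∑ b : {i // ¬ J i} → V,
        (∏ i, q i.1 (a i)) * (∏ i, q i.1 (b i)) *
          g ((Equiv.piEquivPiSubtypeProd J (fun _ => V)).symm (a, b)) =
      (∏ i, q i.1 (a i)) * g ((Equiv.piEquivPiSubtypeProd J (fun _ => V)).symm
        (a, fun _ => v0)) := by
    intro q a
    have h1 : ∀ b : {i // ¬ J i} → V,
        g ((Equiv.piEquivPiSubtypeProd J (fun _ => V)).symm (a, b)) =
        g ((Equiv.piEquivPiSubtypeProd J (fun _ => V)).symm (a, fun _ => v0)) := by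
      intro b
      refine hg _ _ fun i hi => ?_
      simp [Equiv.piEquivPiSubtypeProd, hi]
    simp_rw [h1]
    rw [← Finset.sum_mul, ← Finset.mul_sum, sum_prod_one (fun i : {i // ¬ J i} => q i.1), mul_one]
  rw [key, key]
  simp_rw [key2]
  refine Finset.sum_congr rfl fun a _ => ?_
  congr 1
  refine Finset.prod_congr rfl fun i _ => ?_
  rw [hp i.1 i.2]

/-! ### The coupling -/

/-- Combinatorial data for the coupling. -/
structure AvoidData (n k : ℕ) (S : Type) where
  col : Fin n → S
  sur : Function.Surjective col
  sig : Equiv.Perm (Fin n)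
  sig_col : ∀ v, col (sig v) = col v
  sig_ne : ∀ v, sig v ≠ v
  tau : Fin k → Equiv.Perm S
  lift : Fin k → Equiv.Perm (Fin n)
  lift_col : ∀ j v, col (lift j v) = tau j (col v)
  tau_ne : ∀ i j s, i ≠ j → tau i s ≠ tau j s

namespace AvoidData

set_option linter.unusedSectionVars false

variable {n k : ℕ} {S : Type} [Fintype S] [DecidableEq S] (D : AvoidData n k S)

/-- The vertices in a column. -/
def fib (c : S) : Finset (Fin n) := Finset.univ.filter (fun v => D.col v = c)

lemma mem_fib (c : S) (v : Fin n) : v ∈ D.fib c ↔ D.col v = c := by simp [fib]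

lemma fib_nonempty (c : S) : (D.fib c).Nonempty := by
  obtain ⟨v, hv⟩ := D.sur c
  exact ⟨v, (D.mem_fib c v).2 hv⟩

/-- Size of a column. -/
def sz (c : S) : ℕ := (D.fib c).card

lemma sz_tau (j : Fin k) (c : S) : D.sz (D.tau j c) = D.sz c := by
  symm
  refine Finset.card_bij (fun v _ => D.lift j v) ?_ ?_ ?_
  · intro v hv
    rw [mem_fib] at hv ⊢
    rw [D.lift_col, hv]
  · intro a _ b _ h
    exact (D.lift j).injective h
  · intro b hb
    rw [mem_fib] at hb
    refine ⟨(D.lift j).symm b, ?_, by simp⟩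
    rw [mem_fib]
    have := D.lift_col j ((D.lift j).symm b)
    rw [Equiv.apply_symm_apply, hb] at this
    exact (D.tau j).injective this.symm

lemma two_le_sz (c : S) : 2 ≤ D.sz c := by
  obtain ⟨v, hv⟩ := D.sur c
  have : ({v, D.sig v} : Finset (Fin n)) ⊆ D.fib c := by
    intro w hw
    rw [mem_fib]
    simp only [Finset.mem_insert, Finset.mem_singleton] at hw
    rcases hw with rfl | rfl
    · exact hv
    · rw [D.sig_col, hv]
  have h2 := Finset.card_le_card this
  rwa [Finset.card_pair (D.sig_ne v).symm] at h2

lemma sum_sz : ∑ c, D.sz c = n := by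
  have := Finset.card_eq_sum_card_fiberwise (f := D.col) (s := Finset.univ) (t := Finset.univ)
    (by simp)
  simp only [Finset.card_univ, Fintype.card_fin] at this
  exact this.symm

/-- Uniform law on a column. -/
noncomputable def u (c : S) : PMF (Fin n) := PMF.uniformOfFinset (D.fib c) (D.fib_nonempty c)

lemma u_apply (c : S) (v : Fin n) :
    D.u c v = if D.col v = c then (D.sz c : ENNReal)⁻¹ else 0 := by
  simp [u, PMF.uniformOfFinset_apply, mem_fib, sz]

lemma erase_nonempty (v : Fin n) : ((D.fib (D.col v)).erase v).Nonempty :=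
  ⟨D.sig v, by simp [mem_fib, D.sig_col, D.sig_ne]⟩

/-- Uniform law on the column of `v`, with `v` removed. -/
noncomputable def r (v : Fin n) : PMF (Fin n) :=
  PMF.uniformOfFinset ((D.fib (D.col v)).erase v) (D.erase_nonempty v)

lemma r_apply (v w : Fin n) : D.r v w =
    if w ≠ v ∧ D.col w = D.col v then ((D.sz (D.col v) - 1 : ℕ) : ENNReal)⁻¹ else 0 := by
  have h : v ∈ D.fib (D.col v) := by simp [mem_fib]
  simp [r, PMF.uniformOfFinset_apply, mem_fib, sz, Finset.card_erase_of_mem h]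

lemma u_r (c : S) (w : Fin n) : ∑ y, D.u c y * D.r y w = D.u c w := by
  have h2 := D.two_le_sz c
  by_cases hw : D.col w = c
  · have h1 : ∀ y, D.u c y * D.r y w = if y ∈ (D.fib c).erase w then
        (D.sz c : ENNReal)⁻¹ * ((D.sz c - 1 : ℕ) : ENNReal)⁻¹ else 0 := by
      intro y
      rw [u_apply, r_apply]
      by_cases hy : D.col y = c
      · by_cases hyw : y = w
        · simp [hyw]
        · simp [hyw, hy, hw, mem_fib, Ne.symm hyw]
      · simp [hy, mem_fib]
    simp_rw [h1]
    rw [Finset.sum_ite_mem, Finset.univ_inter, Finset.sum_const,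
      Finset.card_erase_of_mem ((D.mem_fib c w).2 hw), u_apply, if_pos hw, nsmul_eq_mul]
    change ((D.sz c - 1 : ℕ) : ENNReal) * _ = _
    rw [mul_comm, mul_assoc, ENNReal.inv_mul_cancel, mul_one]
    · have : D.sz c - 1 ≠ 0 := by omega
      exact_mod_cast this
    · exact ENNReal.natCast_ne_top _
  · rw [u_apply, if_neg hw]
    refine Finset.sum_eq_zero fun y _ => ?_
    rw [u_apply, r_apply]
    by_cases hy : D.col y = c
    · simp [hy, hw]
    · simp [hy]

lemma two_le_n (D : AvoidData n k S) (s : S) : 2 ≤ n := by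
  have h := D.two_le_sz s
  have h2 : D.sz s ≤ ∑ c, D.sz c := Finset.single_le_sum (fun _ _ => Nat.zero_le _) (Finset.mem_univ s)
  rw [D.sum_sz] at h2
  omega

/-- Law of the shared move. -/
noncomputable def W (s : S) : PMF S :=
  PMF.ofFintype (fun s' => ((D.sz s' - (if s' = s then 1 else 0) : ℕ) : ENNReal) *
    ((n - 1 : ℕ) : ENNReal)⁻¹) (by
    have hn := D.two_le_n s
    rw [← Finset.sum_mul, ← Nat.cast_sum]
    have : ∑ s', (D.sz s' - (if s' = s then 1 else 0)) = n - 1 := by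
      have h : ∑ s', (D.sz s' - (if s' = s then 1 else 0)) + ∑ s', (if s' = s then 1 else 0) = n := by
        rw [← Finset.sum_add_distrib]
        refine Eq.trans ?_ D.sum_sz
        refine Finset.sum_congr rfl fun c _ => ?_
        have := D.two_le_sz c
        split_ifs <;> omega
      rw [Finset.sum_ite_eq' Finset.univ s] at h
      simp only [Finset.mem_univ, if_true] at h
      omega
    rw [this]
    refine ENNReal.mul_inv_cancel ?_ (ENNReal.natCast_ne_top _)
    have : n - 1 ≠ 0 := by omega
    exact_mod_cast this)

lemma W_apply (s s' : S) : D.W s s' =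
    ((D.sz s' - (if s' = s then 1 else 0) : ℕ) : ENNReal) * ((n - 1 : ℕ) : ENNReal)⁻¹ := rfl

open scoped Classical in
/-- Law of the move of walker `j`, given the shared move from `s` to `s'`. -/
noncomputable def h (s s' : S) (j : Fin k) (x : Fin k → Fin n) : PMF (Fin n) :=
  if s = s' then D.r (x j)
  else if H : ∃ l, j < l ∧ D.tau l s = D.tau j s' then PMF.pure (D.sig (x H.choose))
  else D.u (D.tau j s')

lemma h_congr (s s' : S) (j : Fin k) (x y : Fin k → Fin n) (hxy : ∀ i, j ≤ i → x i = y i) :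
    D.h s s' j x = D.h s s' j y := by
  unfold h
  split_ifs with h1 h2
  · rw [hxy j le_rfl]
  · rw [hxy _ h2.choose_spec.1.le]
  · rfl

lemma h_apply_of (s s' : S) (hs : s ≠ s') (j l : Fin k) (hl : j < l)
    (hl2 : D.tau l s = D.tau j s') (x : Fin k → Fin n) :
    D.h s s' j x = PMF.pure (D.sig (x l)) := by
  have H : ∃ l, j < l ∧ D.tau l s = D.tau j s' := ⟨l, hl, hl2⟩
  unfold h
  rw [if_neg hs, dif_pos H]
  have : H.choose = l := by
    by_contra hne
    exact D.tau_ne _ _ s hne (H.choose_spec.2.trans hl2.symm)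
  rw [this]

lemma h_apply_not (s s' : S) (hs : s ≠ s') (j : Fin k)
    (H : ¬ ∃ l, j < l ∧ D.tau l s = D.tau j s') (x : Fin k → Fin n) :
    D.h s s' j x = D.u (D.tau j s') := by
  unfold h
  rw [if_neg hs, dif_neg H]

lemma h_self (s : S) (j : Fin k) (x : Fin k → Fin n) : D.h s s j x = D.r (x j) := by
  unfold h; rw [if_pos rfl]

/-- Transition law of the shared state and all walkers. -/
noncomputable def P (z : S × (Fin k → Fin n)) : PMF (S × (Fin k → Fin n)) :=
  PMF.ofFintype (fun z' => D.W z.1 z'.1 * ∏ j, D.h z.1 z'.1 j z.2 (z'.2 j)) (by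
    rw [Fintype.sum_prod_type]
    simp_rw [← Finset.mul_sum]
    simp [sum_prod_one, pmf_sum_one])

lemma P_apply (z z' : S × (Fin k → Fin n)) : D.P z z' =
    D.W z.1 z'.1 * ∏ j, D.h z.1 z'.1 j z.2 (z'.2 j) := rfl

/-- Initial law. -/
noncomputable def init (s0 : S) : PMF (S × (Fin k → Fin n)) :=
  PMF.ofFintype (fun z => (if z.1 = s0 then 1 else 0) * ∏ j, D.u (D.tau j s0) (z.2 j)) (by
    rw [Fintype.sum_prod_type, Finset.sum_comm]
    simp_rw [← Finset.sum_mul]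
    simp [sum_prod_one (fun j => D.u (D.tau j s0))])

lemma init_apply (s0 : S) (z : S × (Fin k → Fin n)) : D.init s0 z =
    (if z.1 = s0 then 1 else 0) * ∏ j, D.u (D.tau j s0) (z.2 j) := rfl

/-- A configuration compatible with the shared state. -/
def Valid (z : S × (Fin k → Fin n)) : Prop := ∀ i, D.col (z.2 i) = D.tau i z.1

lemma valid_init (s0 : S) (z : S × (Fin k → Fin n)) (hz : D.init s0 z ≠ 0) : D.Valid z := by
  intro i
  rw [init_apply] at hz
  have h1 := left_ne_zero_of_mul hz
  have h2 := Finset.prod_ne_zero_iff.1 (right_ne_zero_of_mul hz) i (Finset.mem_univ i)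
  rw [u_apply] at h2
  have h3 : z.1 = s0 := by by_contra hne; simp [hne] at h1
  rw [h3]
  by_contra hne
  simp [hne] at h2

lemma h_col (z : S × (Fin k → Fin n)) (hv : D.Valid z) (s' : S) (i : Fin k) (w : Fin n)
    (hw : D.h z.1 s' i z.2 w ≠ 0) : D.col w = D.tau i s' := by
  by_cases hs : z.1 = s'
  · subst hs
    rw [h_self, r_apply] at hw
    by_contra hne
    rw [← hv i] at hne
    simp [hne] at hw
  · by_cases H : ∃ l, i < l ∧ D.tau l z.1 = D.tau i s'
    · obtain ⟨l, hl, hl2⟩ := H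
      rw [D.h_apply_of _ _ hs i l hl hl2] at hw
      have : w = D.sig (z.2 l) := by
        by_contra hne
        simp [hne] at hw
      rw [this, D.sig_col, hv l, hl2]
    · rw [D.h_apply_not _ _ hs i H, u_apply] at hw
      by_contra hne
      simp [hne] at hw

lemma P_ne_zero (z z' : S × (Fin k → Fin n)) (hz : D.P z z' ≠ 0) (i : Fin k) :
    D.h z.1 z'.1 i z.2 (z'.2 i) ≠ 0 := by
  rw [P_apply] at hz
  exact Finset.prod_ne_zero_iff.1 (right_ne_zero_of_mul hz) i (Finset.mem_univ i)

lemma valid_step (z z' : S × (Fin k → Fin n)) (hv : D.Valid z) (hz : D.P z z' ≠ 0) :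
    D.Valid z' := fun i => D.h_col z hv z'.1 i _ (D.P_ne_zero z z' hz i)

lemma weight_valid (s0 : S) (A : ℕ → (S × (Fin k → Fin n)) → Prop) (t : ℕ)
    (z : S × (Fin k → Fin n)) (hz : chainWeight (D.init s0) D.P A t z ≠ 0) :
    A t z ∧ D.Valid z := by
  induction t generalizing z with
  | zero =>
    by_cases hA : A 0 z
    · simp only [chainWeight, hA, if_true] at hz
      exact ⟨hA, D.valid_init s0 z hz⟩
    · simp [chainWeight, hA] at hz
  | succ t ih =>
    by_cases hA : A (t + 1) z
    · simp only [chainWeight, hA, if_true] at hz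
      obtain ⟨y, _, hy⟩ := Finset.exists_ne_zero_of_sum_ne_zero hz
      exact ⟨hA, D.valid_step y z (ih y (left_ne_zero_of_mul hy)).2 (right_ne_zero_of_mul hy)⟩
    · simp [chainWeight, hA] at hz

lemma avoid_step (z z' : S × (Fin k → Fin n)) (hv : D.Valid z) (hz : D.P z z' ≠ 0)
    (i j : Fin k) (hij : j < i) : z'.2 j ≠ z.2 i := by
  intro he
  have hc := D.valid_step z z' hv hz j
  rw [he, hv i] at hc
  by_cases hs : z.1 = z'.1
  · rw [hs] at hc
    exact D.tau_ne i j _ hij.ne' hc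
  · have := D.P_ne_zero z z' hz j
    rw [D.h_apply_of _ _ hs j i hij hc, he] at this
    have h2 : z.2 i = D.sig (z.2 i) := by
      by_contra hne
      simp [hne] at this
    exact D.sig_ne _ h2.symm

lemma avoid_same (z : S × (Fin k → Fin n)) (hv : D.Valid z)
    (i j : Fin k) (hij : i ≠ j) : z.2 i ≠ z.2 j := by
  intro he
  have := hv i
  rw [he, hv j] at this
  exact D.tau_ne i j _ hij this.symm

/-! ### Each walker is a faithful walk -/

/-- Shared state read off from the position of walker `j`. -/
def dec (j : Fin k) (v : Fin n) : S := (D.tau j).symm (D.col v)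

lemma dec_eq_iff (j : Fin k) (v : Fin n) (s : S) : s = D.dec j v ↔ D.col v = D.tau j s := by
  rw [dec, Equiv.eq_symm_apply, eq_comm]

/-- Conditional law of the walkers given that walker `j` is at `v`. -/
noncomputable def lam (j : Fin k) (v : Fin n) (i : Fin k) : PMF (Fin n) :=
  if i = j then PMF.pure v else D.u (D.tau i (D.dec j v))

/-- Modified move laws, where the walkers before `j` are refreshed. -/
noncomputable def hh (j : Fin k) (s s' : S) (i : Fin k) (x : Fin k → Fin n) : PMF (Fin n) :=
  if j ≤ i then D.h s s' i x else D.u (D.tau i s')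

lemma hh_congr (j : Fin k) (s s' : S) (i : Fin k) (x y : Fin k → Fin n)
    (hxy : ∀ i, j ≤ i → x i = y i) : D.hh j s s' i x = D.hh j s s' i y := by
  unfold hh
  split_ifs with hi
  · exact D.h_congr s s' i x y (fun l hl => hxy l (hi.trans hl))
  · rfl

lemma keyA_same (j : Fin k) (v : Fin n) (x' : Fin k → Fin n) :
    ∑ x : Fin k → Fin n, (∏ i, D.lam j v i (x i)) *
      ∏ i, D.hh j (D.dec j v) (D.dec j v) i x (x' i) =
    ∏ i, (if i = j then D.r v else D.u (D.tau i (D.dec j v))) (x' i) := by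
  have e : ∀ x : Fin k → Fin n, (∏ i, D.lam j v i (x i)) *
      ∏ i, D.hh j (D.dec j v) (D.dec j v) i x (x' i) =
      ∏ i, (D.lam j v i (x i) *
        (if j ≤ i then D.r (x i) else D.u (D.tau i (D.dec j v))) (x' i)) := by
    intro x
    rw [← Finset.prod_mul_distrib]
    refine Finset.prod_congr rfl fun i _ => ?_
    simp only [hh, h_self]
  simp_rw [e]
  rw [← Fintype.prod_sum (fun i y => D.lam j v i y *
        (if j ≤ i then D.r y else D.u (D.tau i (D.dec j v))) (x' i))]
  refine Finset.prod_congr rfl fun i _ => ?_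
  unfold lam
  by_cases hij : i = j
  · subst hij
    simp [PMF.pure_apply]
  · by_cases hle : j ≤ i
    · simp only [hij, hle, if_true, if_false]
      exact D.u_r _ _
    · simp only [hij, hle, if_false]
      rw [← Finset.sum_mul, pmf_sum_one, one_mul]

lemma prod_ite_unique {ι : Type} (s : Finset ι) (q : ι → Prop) [DecidablePred q]
    [Decidable (∃ i ∈ s, q i)]
    (hq : ∀ i ∈ s, ∀ i' ∈ s, q i → q i' → i = i') (a : ENNReal) :
    (∏ i ∈ s, if q i then a else 1) = if ∃ i ∈ s, q i then a else 1 := by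
  classical
  split_ifs with H
  · obtain ⟨i, hi, hqi⟩ := H
    rw [Finset.prod_eq_single_of_mem i hi]
    · simp [hqi]
    · intro b hb hne
      rw [if_neg]
      intro hqb
      exact hne (hq b hb i hi hqb hqi)
  · refine Finset.prod_eq_one fun i hi => ?_
    rw [if_neg]
    exact fun hqi => H ⟨i, hi, hqi⟩

lemma keyA_diff (j : Fin k) (v : Fin n) (s' : S) (hs : D.dec j v ≠ s') (x' : Fin k → Fin n) :
    ∑ x : Fin k → Fin n, (∏ i, D.lam j v i (x i)) *
      ∏ i, D.hh j (D.dec j v) s' i x (x' i) =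
    ∏ i, D.u (D.tau i s') (x' i) := by
  classical
  set s := D.dec j v with hsdef
  -- the relation "walker `i` takes its value from walker `l`"
  let R : Fin k → Fin k → Prop := fun i l => j ≤ i ∧ i < l ∧ D.tau l s = D.tau i s'
  have hRl : ∀ i l l', R i l → R i l' → l = l' := by
    intro i l l' h1 h2
    by_contra hne
    exact D.tau_ne _ _ s hne (h1.2.2.trans h2.2.2.symm)
  have hRi : ∀ i i' l, R i l → R i' l → i = i' := by
    intro i i' l h1 h2
    by_contra hne
    exact D.tau_ne _ _ s' hne (h1.2.2.symm.trans h2.2.2)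
  have hhe : ∀ (x : Fin k → Fin n) i, D.hh j s s' i x (x' i) =
      (∏ l, if R i l then (if x' i = D.sig (x l) then (1 : ENNReal) else 0) else 1) *
        (if ∃ l ∈ Finset.univ, R i l then 1 else D.u (D.tau i s') (x' i)) := by
    intro x i
    by_cases H : ∃ l ∈ Finset.univ, R i l
    · rw [if_pos H, mul_one]
      obtain ⟨l, -, hl⟩ := H
      rw [Finset.prod_eq_single_of_mem l (Finset.mem_univ l)]
      · rw [if_pos hl, hh, if_pos hl.1, D.h_apply_of s s' hs i l hl.2.1 hl.2.2, PMF.pure_apply]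
        congr
      · intro b _ hne
        rw [if_neg]
        exact fun hb => hne (hRl i b l hb hl)
    · rw [if_neg H, Finset.prod_eq_one, one_mul]
      · unfold hh
        split_ifs with hji
        · rw [D.h_apply_not s s' hs]
          rintro ⟨l, hl1, hl2⟩
          exact H ⟨l, Finset.mem_univ _, hji, hl1, hl2⟩
        · rfl
      · intro l _
        rw [if_neg]
        exact fun hb => H ⟨l, Finset.mem_univ l, hb⟩
  have e : ∀ x : Fin k → Fin n, (∏ i, D.lam j v i (x i)) * ∏ i, D.hh j s s' i x (x' i) =
      (∏ l, (D.lam j v l (x l) *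
        ∏ i, if R i l then (if x' i = D.sig (x l) then (1 : ENNReal) else 0) else 1)) *
      ∏ i, (if ∃ l ∈ Finset.univ, R i l then 1 else D.u (D.tau i s') (x' i)) := by
    intro x
    rw [Finset.prod_congr rfl (fun i _ => hhe x i), Finset.prod_mul_distrib,
      Finset.prod_mul_distrib, ← mul_assoc]
    congr 2
    exact Finset.prod_comm
  simp_rw [e]
  rw [← Finset.sum_mul, ← Fintype.prod_sum (fun l y => D.lam j v l y *
        ∏ i, if R i l then (if x' i = D.sig y then (1 : ENNReal) else 0) else 1)]
  have e2 : ∀ l, ∑ y, D.lam j v l y *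
        (∏ i, if R i l then (if x' i = D.sig y then (1 : ENNReal) else 0) else 1) =
      ∏ i, if R i l then D.u (D.tau i s') (x' i) else 1 := by
    intro l
    by_cases H : ∃ i, R i l
    · obtain ⟨i, hi⟩ := H
      have hlj : l ≠ j := (lt_of_le_of_lt hi.1 hi.2.1).ne'
      rw [Finset.prod_eq_single_of_mem i (Finset.mem_univ i)]
      · have e3 : ∀ y, D.lam j v l y *
            (∏ i, if R i l then (if x' i = D.sig y then (1 : ENNReal) else 0) else 1) =
            if D.sig.symm (x' i) = y then D.u (D.tau l s) y else 0 := by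
          intro y
          rw [Finset.prod_eq_single_of_mem i (Finset.mem_univ i)]
          · rw [if_pos hi, lam, if_neg hlj, ← hsdef]
            by_cases hy : x' i = D.sig y
            · simp [hy]
            · rw [if_neg hy, if_neg, mul_zero]
              intro h'
              apply hy
              rw [← h']; simp
          · intro b _ hne
            rw [if_neg]
            exact fun hb => hne (hRi b i l hb hi)
        simp_rw [e3]
        rw [Finset.sum_ite_eq, if_pos (Finset.mem_univ _), if_pos hi, u_apply, u_apply,
          hi.2.2]
        have : D.col (D.sig.symm (x' i)) = D.col (x' i) := by
          have := D.sig_col (D.sig.symm (x' i))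
          rw [Equiv.apply_symm_apply] at this
          exact this.symm
        rw [this]
      · intro b _ hne
        rw [if_neg]
        exact fun hb => hne (hRi b i l hb hi)
    · push Not at H
      simp [H, pmf_sum_one]
  rw [Finset.prod_congr rfl (fun l _ => e2 l), Finset.prod_comm, ← Finset.prod_mul_distrib]
  refine Finset.prod_congr rfl fun i _ => ?_
  rw [prod_ite_unique Finset.univ (R i) (fun l _ l' _ => hRl i l l')]
  split_ifs <;> simp

/-- One step probability of the walk on the loopless complete graph. -/
noncomputable def q (v v' : Fin n) : ENNReal := if v' = v then 0 else ((n - 1 : ℕ) : ENNReal)⁻¹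

lemma keyB (j : Fin k) (v v' : Fin n) (s' : S) (x' : Fin k → Fin n) :
    D.W (D.dec j v) s' * (∑ x : Fin k → Fin n, (∏ i, D.lam j v i (x i)) *
      ∏ i, D.hh j (D.dec j v) s' i x (x' i)) * (if x' j = v' then 1 else 0) =
    q v v' * ((if s' = D.dec j v' then 1 else 0) * ∏ i, D.lam j v' i (x' i)) := by
  by_cases hx : x' j = v'
  swap
  · rw [if_neg hx, mul_zero, Finset.prod_eq_zero (Finset.mem_univ j), mul_zero, mul_zero]
    simp [lam, hx]
  rw [if_pos hx, mul_one]
  have hlam : ∏ i, D.lam j v' i (x' i) =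
      ∏ i ∈ Finset.univ.erase j, D.u (D.tau i (D.dec j v')) (x' i) := by
    rw [← Finset.mul_prod_erase Finset.univ _ (Finset.mem_univ j)]
    have : D.lam j v' j (x' j) = 1 := by simp [lam, hx]
    rw [this, one_mul]
    refine Finset.prod_congr rfl fun i hi => ?_
    rw [lam, if_neg (Finset.ne_of_mem_erase hi)]
  rw [hlam]
  by_cases hs : D.dec j v = s'
  · rw [← hs, keyA_same, ← Finset.mul_prod_erase Finset.univ _ (Finset.mem_univ j), if_pos rfl, hx]
    have e1 : ∏ i ∈ Finset.univ.erase j,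
        (if i = j then D.r v else D.u (D.tau i (D.dec j v))) (x' i) =
        ∏ i ∈ Finset.univ.erase j, D.u (D.tau i (D.dec j v)) (x' i) := by
      refine Finset.prod_congr rfl fun i hi => ?_
      rw [if_neg (Finset.ne_of_mem_erase hi)]
    rw [e1, ← mul_assoc]
    by_cases hc : D.dec j v = D.dec j v'
    · rw [if_pos hc, one_mul, hc]
      congr 1
      rw [← hc, W_apply, r_apply, q]
      have hc' : D.col v' = D.col v := by
        have := congrArg (D.tau j) hc
        simpa [dec] using this.symm
      by_cases hv : v' = v
      · simp [hv]
      · rw [if_pos rfl, if_pos ⟨hv, hc'⟩, if_neg hv]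
        have e2 : D.sz (D.dec j v) = D.sz (D.col v) := by
          rw [← D.sz_tau j]; simp [dec]
        rw [e2, mul_right_comm, ENNReal.mul_inv_cancel, one_mul]
        · have := D.two_le_sz (D.col v)
          have : D.sz (D.col v) - 1 ≠ 0 := by omega
          exact_mod_cast this
        · exact ENNReal.natCast_ne_top _
    · rw [if_neg hc, zero_mul, mul_zero, r_apply, if_neg, mul_zero, zero_mul]
      rintro ⟨_, h2⟩
      apply hc
      rw [dec, dec, h2]
  · rw [D.keyA_diff j v s' hs, ← Finset.mul_prod_erase Finset.univ _ (Finset.mem_univ j), hx,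
      ← mul_assoc]
    by_cases hc : s' = D.dec j v'
    · rw [if_pos hc, one_mul, ← hc]
      congr 1
      have hv : v' ≠ v := by
        rintro rfl
        exact hs hc.symm
      rw [W_apply, u_apply, q, if_neg hv, if_pos ((D.dec_eq_iff j v' s').1 hc),
        if_neg (Ne.symm hs), D.sz_tau, Nat.sub_zero, mul_right_comm, ENNReal.mul_inv_cancel, one_mul]
      · have := D.two_le_sz s'
        have : D.sz s' ≠ 0 := by omega
        exact_mod_cast this
      · exact ENNReal.natCast_ne_top _
    · rw [if_neg hc, zero_mul, mul_zero, u_apply, if_neg, mul_zero, zero_mul]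
      exact fun h2 => hc ((D.dec_eq_iff j v' s').2 h2)

/-- Functions of the shared state and the walkers from `j` on. -/
def Good (j : Fin k) (g : S × (Fin k → Fin n) → ENNReal) : Prop :=
  ∀ s x y, (∀ i, j ≤ i → x i = y i) → g (s, x) = g (s, y)

/-- Conditional expectation given that walker `j` sits at `v`. -/
noncomputable def L (j : Fin k) (v : Fin n) (g : S × (Fin k → Fin n) → ENNReal) : ENNReal :=
  ∑ x, (∏ i, D.lam j v i (x i)) * g (D.dec j v, x)

lemma L_one (j : Fin k) (v : Fin n) : D.L j v (fun _ => 1) = 1 := by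
  simp [L, sum_prod_one]

lemma P_good (j : Fin k) (v' : Fin n) (g : S × (Fin k → Fin n) → ENNReal) (hg : Good j g)
    (s : S) (x : Fin k → Fin n) :
    ∑ z', D.P (s, x) z' * ((if z'.2 j = v' then 1 else 0) * g z') =
      ∑ s', ∑ x' : Fin k → Fin n, D.W s s' * (∏ i, D.hh j s s' i x (x' i)) *
        ((if x' j = v' then 1 else 0) * g (s', x')) := by
  rw [Fintype.sum_prod_type]
  refine Finset.sum_congr rfl fun s' _ => ?_
  simp only [P_apply, mul_assoc]
  rw [← Finset.mul_sum, ← Finset.mul_sum]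
  congr 1
  refine sum_replace v' (fun i => D.h s s' i x) (fun i => D.hh j s s' i x) (fun i => j ≤ i) ?_
    (fun x' => (if x' j = v' then 1 else 0) * g (s', x')) ?_
  · intro i hi
    rw [hh, if_pos hi]
  · intro a b hab
    simp only [hab j le_rfl, hg s' a b hab]

lemma good_step (j : Fin k) (v' : Fin n) (g : S × (Fin k → Fin n) → ENNReal) (hg : Good j g) :
    Good j (fun z => ∑ z', D.P z z' * ((if z'.2 j = v' then 1 else 0) * g z')) := by
  intro s x y hxy
  dsimp only
  rw [P_good _ _ _ _ hg, P_good _ _ _ _ hg]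
  simp only [D.hh_congr j s _ _ x y hxy]

lemma L_step (j : Fin k) (v v' : Fin n) (g : S × (Fin k → Fin n) → ENNReal) (hg : Good j g) :
    D.L j v (fun z => ∑ z', D.P z z' * ((if z'.2 j = v' then 1 else 0) * g z')) =
      q v v' * D.L j v' g := by
  unfold L
  simp_rw [D.P_good j v' g hg, Finset.mul_sum]
  rw [Finset.sum_comm]
  have e : ∀ s', ∑ x : Fin k → Fin n, ∑ x' : Fin k → Fin n, (∏ i, D.lam j v i (x i)) *
      (D.W (D.dec j v) s' * (∏ i, D.hh j (D.dec j v) s' i x (x' i)) *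
        ((if x' j = v' then 1 else 0) * g (s', x'))) =
      if s' = D.dec j v' then ∑ x' : Fin k → Fin n,
        q v v' * ((∏ i, D.lam j v' i (x' i)) * g (s', x')) else 0 := by
    intro s'
    rw [Finset.sum_comm]
    have e1 : ∀ x' : Fin k → Fin n, ∑ x : Fin k → Fin n, (∏ i, D.lam j v i (x i)) *
      (D.W (D.dec j v) s' * (∏ i, D.hh j (D.dec j v) s' i x (x' i)) *
        ((if x' j = v' then 1 else 0) * g (s', x'))) =
        q v v' * ((if s' = D.dec j v' then 1 else 0) * ∏ i, D.lam j v' i (x' i)) * g (s', x') := by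
      intro x'
      rw [← keyB, Finset.mul_sum, Finset.sum_mul, Finset.sum_mul]
      refine Finset.sum_congr rfl fun x _ => ?_
      ring
    simp_rw [e1]
    split_ifs
    · simp [mul_assoc]
    · simp
  simp_rw [e]
  rw [Finset.sum_ite_eq' Finset.univ, if_pos (Finset.mem_univ _)]

lemma weight_L (s0 : S) (j : Fin k) (v : ℕ → Fin n) (t : ℕ) :
    ∀ g : S × (Fin k → Fin n) → ENNReal, Good j g →
    ∑ z, chainWeight (D.init s0) D.P (fun s z => z.2 j = v s) t z * g z =
      (∑ z, chainWeight (D.init s0) D.P (fun s z => z.2 j = v s) t z) * D.L j (v t) g := by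
  induction t with
  | zero =>
    have key : ∀ g : S × (Fin k → Fin n) → ENNReal,
        ∑ z, chainWeight (D.init s0) D.P (fun s z => z.2 j = v s) 0 z * g z =
        D.u (D.tau j s0) (v 0) * D.L j (v 0) g := by
      intro g
      rw [chainWeight_sum_zero, Fintype.sum_prod_type, L]
      simp only [init_apply]
      rw [Finset.sum_eq_single_of_mem s0 (Finset.mem_univ _)
        (fun s _ hne => by simp [hne]), Finset.mul_sum]
      refine Finset.sum_congr rfl fun x _ => ?_
      rw [if_pos rfl, one_mul, ← Finset.mul_prod_erase Finset.univ _ (Finset.mem_univ j),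
        ← Finset.mul_prod_erase Finset.univ (fun i => D.lam j (v 0) i (x i)) (Finset.mem_univ j)]
      by_cases hx : x j = v 0
      · have h1 : D.lam j (v 0) j (x j) = 1 := by simp [lam, hx]
        rw [h1, if_pos hx, one_mul, one_mul, hx, mul_assoc]
        by_cases hc : D.col (v 0) = D.tau j s0
        · rw [← (D.dec_eq_iff j (v 0) s0).2 hc]
          congr 2
          refine Finset.prod_congr rfl fun i hi => ?_
          rw [lam, if_neg (Finset.ne_of_mem_erase hi), ← (D.dec_eq_iff j (v 0) s0).2 hc]
        · rw [u_apply, if_neg hc, zero_mul, zero_mul]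
      · have h1 : D.lam j (v 0) j (x j) = 0 := by simp [lam, hx]
        rw [h1, if_neg hx]
        simp
    intro g _
    rw [key g]
    have := key (fun _ => 1)
    simp only [mul_one, L_one] at this
    rw [this]
  | succ t ih =>
    have key : ∀ g : S × (Fin k → Fin n) → ENNReal, Good j g →
        ∑ z, chainWeight (D.init s0) D.P (fun s z => z.2 j = v s) (t + 1) z * g z =
        (∑ z, chainWeight (D.init s0) D.P (fun s z => z.2 j = v s) t z) *
          (q (v t) (v (t + 1)) * D.L j (v (t + 1)) g) := by
      intro g hg
      rw [chainWeight_sum_succ, ih, L_step _ _ _ _ _ hg]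
      exact D.good_step j _ g hg
    intro g hg
    rw [key g hg]
    have := key (fun _ => 1) (fun _ _ _ _ => rfl)
    simp only [mul_one, L_one] at this
    rw [this, mul_assoc]

lemma weight_walk (s0 : S) (j : Fin k) (v : ℕ → Fin n) (t : ℕ) :
    ∑ z, chainWeight (D.init s0) D.P (fun s z => z.2 j = v s) (t + 1) z =
      (∑ z, chainWeight (D.init s0) D.P (fun s z => z.2 j = v s) t z) *
        q (v t) (v (t + 1)) := by
  have h1 := chainWeight_sum_succ (D.init s0) D.P (fun s z => z.2 j = v s) t (fun _ => 1)
  have hg : Good j (fun _ : S × (Fin k → Fin n) => (1 : ENNReal)) := fun _ _ _ _ => rfl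
  rw [D.weight_L s0 j v t _ (D.good_step j (v (t + 1)) _ hg), L_step _ _ _ _ _ hg, L_one,
    mul_one] at h1
  simpa using h1

/-! ### The coupling is Markovian -/

/-- Transition rules of the individual walkers. -/
noncomputable def f (hk : 0 < k) (j : Fin k) (x : Fin k → Fin n) : PMF (Fin n) :=
  if j = ⟨0, hk⟩ then (D.W (D.dec j (x j))).bind (fun s' => D.h (D.dec j (x j)) s' j x)
  else D.h (D.dec j (x j)) (D.dec ⟨0, hk⟩ (x ⟨0, hk⟩)) j x

lemma sum_P_fix (z : S × (Fin k → Fin n)) (J : Fin k → Prop) [DecidablePred J]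
    (v : Fin k → Fin n) :
    ∑ z', D.P z z' * (if ∀ i, J i → z'.2 i = v i then 1 else 0) =
      ∑ s', D.W z.1 s' * ∏ i, if J i then D.h z.1 s' i z.2 (v i) else 1 := by
  rw [Fintype.sum_prod_type]
  refine Finset.sum_congr rfl fun s' _ => ?_
  simp only [P_apply, mul_assoc]
  rw [← Finset.mul_sum]
  congr 1
  rw [← sum_prod_fix (fun i => D.h z.1 s' i z.2) J v]
  refine Finset.sum_congr rfl fun x _ => ?_
  congr

lemma markov_step (hk : 0 < k) (z : S × (Fin k → Fin n)) (hz : D.Valid z) (j : Fin k)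
    (v' : Fin k → Fin n) (w : Fin n) :
    ∑ z', D.P z z' * (if (∀ i < j, z'.2 i = v' i) ∧ z'.2 j = w then 1 else 0) =
      (∑ z', D.P z z' * (if ∀ i < j, z'.2 i = v' i then 1 else 0)) *
        D.f hk j (fun i => if i < j then v' i else z.2 i) w := by
  have e1 := D.sum_P_fix z (fun i => i ≤ j) (Function.update v' j w)
  have e2 := D.sum_P_fix z (fun i => i < j) v'
  rw [e2]
  have e3 : ∀ x : Fin k → Fin n, ((∀ i < j, x i = v' i) ∧ x j = w) ↔
      ∀ i, i ≤ j → x i = Function.update v' j w i := by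
    intro x
    constructor
    · rintro ⟨h1, h2⟩ i hi
      rcases hi.lt_or_eq with h | h
      · rw [Function.update_of_ne h.ne, h1 i h]
      · subst h; simpa using h2
    · intro h
      refine ⟨fun i hi => ?_, by simpa using h j le_rfl⟩
      rw [h i hi.le, Function.update_of_ne hi.ne]
  simp only [e3]
  rw [e1, Finset.sum_mul]
  have e4 : ∀ s', (∏ i, if i ≤ j then D.h z.1 s' i z.2 (Function.update v' j w i) else 1) =
      (∏ i, if i < j then D.h z.1 s' i z.2 (v' i) else 1) * D.h z.1 s' j z.2 w := by
    intro s'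
    rw [← Finset.mul_prod_erase Finset.univ _ (Finset.mem_univ j),
      ← Finset.mul_prod_erase Finset.univ (fun i => if i < j then D.h z.1 s' i z.2 (v' i) else 1)
        (Finset.mem_univ j), if_pos le_rfl, if_neg (lt_irrefl j), one_mul, mul_comm]
    congr 1
    · refine Finset.prod_congr rfl fun i hi => ?_
      have hne := Finset.ne_of_mem_erase hi
      rw [Function.update_of_ne hne]
      by_cases hlt : i < j
      · rw [if_pos hlt, if_pos hlt.le]
      · rw [if_neg hlt, if_neg]
        exact fun hle => hlt (lt_of_le_of_ne hle hne)
    · simp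
  have hdec : D.dec j (z.2 j) = z.1 := ((D.dec_eq_iff j (z.2 j) z.1).2 (hz j)).symm
  have hmix : ∀ s', D.h z.1 s' j (fun i => if i < j then v' i else z.2 i) = D.h z.1 s' j z.2 :=
    fun s' => D.h_congr _ _ _ _ _ (fun i hi => if_neg (not_lt.2 hi))
  unfold f
  simp only [lt_irrefl, if_false, hdec, hmix]
  by_cases hj : j = ⟨0, hk⟩
  · have hno : ∀ i, ¬ i < j := by
      intro i hi
      rw [hj] at hi
      exact absurd hi (by simp [Fin.lt_def])
    simp only [hj, if_true]
    rw [← hj]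
    simp only [e4]
    simp only [hno, if_false, Finset.prod_const_one, one_mul, mul_one]
    rw [← Finset.sum_mul, pmf_sum_one, one_mul, PMF.bind_apply, tsum_fintype]
  · have h0 : (⟨0, hk⟩ : Fin k) < j := by
      rw [Fin.lt_def]
      have : j.1 ≠ 0 := fun h => hj (Fin.ext h)
      show 0 < j.1
      omega
    simp only [hj, if_false, h0, if_true]
    refine Finset.sum_congr rfl fun s' _ => ?_
    rw [e4, ← mul_assoc]
    by_cases hs : D.h z.1 s' ⟨0, hk⟩ z.2 (v' ⟨0, hk⟩) = 0
    · rw [Finset.prod_eq_zero (Finset.mem_univ (⟨0, hk⟩ : Fin k)) (by rw [if_pos h0, hs])]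
      simp
    · have := D.h_col z hz s' _ _ hs
      rw [← (D.dec_eq_iff _ _ _).2 this]

theorem coupling (D : AvoidData n k S) (hk : 0 < k) (s0 : S) : MarkovianAvoidanceCouplingLoopless n k := by
  classical
  letI : MeasurableSpace S := ⊤
  haveI : MeasurableSingletonClass S := ⟨fun _ => trivial⟩
  obtain ⟨Ω, m, μ, Z, hμ, hZ, hA, hB⟩ := chain_exists' (D.init s0) D.P
  refine ⟨Ω, m, μ, fun j t w => (Z t w).2 j, hμ, ?_, ?_, ?_, D.f hk, ?_⟩
  · intro j t
    exact (measurable_pi_apply j).comp (measurable_snd.comp (hZ t))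
  · intro j t v
    have h1 := hA (fun s z => z.2 j = v s) (t + 1)
    have h2 := hA (fun s z => z.2 j = v s) t
    rw [D.weight_walk, ← h2] at h1
    exact h1
  · have hinit : ∀ᵐ w ∂μ, D.Valid (Z 0 w) := by
      have h1 := hA (fun _ z => ¬ D.Valid z) 0
      rw [Finset.sum_eq_zero] at h1
      · rw [ae_iff]
        simpa using h1
      · intro z _
        by_contra hne
        have := D.weight_valid s0 _ 0 z hne
        exact this.1 this.2
    have hstep : ∀ᵐ w ∂μ, ∀ t z, Z t w = z → D.P z (Z (t + 1) w) ≠ 0 := by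
      rw [ae_all_iff]
      intro t
      rw [ae_all_iff]
      intro z
      have h1 := hB (fun s y => s = t → y = z) t (fun y => D.P z y = 0)
      rw [Finset.sum_eq_zero] at h1
      · rw [ae_iff]
        refine measure_mono_null ?_ h1
        intro w hw
        simp only [Set.mem_ofPred_eq, Classical.not_imp, not_not] at hw ⊢
        refine ⟨?_, hw.2⟩
        rintro s _ rfl
        exact hw.1
      · intro y _
        by_cases hy : chainWeight (D.init s0) D.P (fun s y => s = t → y = z) t y = 0
        · rw [hy, zero_mul]
        · have := (D.weight_valid s0 _ t y hy).1 rfl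
          subst this
          rw [Finset.sum_eq_zero, mul_zero]
          intro z' _
          by_cases h : D.P y z' = 0 <;> simp [h]
    filter_upwards [hinit, hstep] with w hw0 hw1
    have hval : ∀ t, D.Valid (Z t w) := by
      intro t
      induction t with
      | zero => exact hw0
      | succ t ih => exact D.valid_step _ _ ih (hw1 t _ rfl)
    refine ⟨fun i j hij => D.avoid_same _ hw0 i j hij, fun t i j => ⟨fun hij => ?_, fun hij => ?_⟩⟩
    · exact D.avoid_same _ (hval (t + 1)) j i hij.ne'
    · exact D.avoid_step _ _ (hval t) (hw1 t _ rfl) i j hij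
  · intro t j v w
    have h1 := hB (fun s z => ∀ i, z.2 i = v i s) t
      (fun z => (∀ i < j, z.2 i = v i (t + 1)) ∧ z.2 j = w)
    have h2 := hB (fun s z => ∀ i, z.2 i = v i s) t (fun z => ∀ i < j, z.2 i = v i (t + 1))
    have e1 : {ω | ((∀ i : Fin k, ∀ s ≤ t, (Z s ω).2 i = v i s) ∧
              (∀ i < j, (Z (t + 1) ω).2 i = v i (t + 1))) ∧ (Z (t + 1) ω).2 j = w} =
        {ω | (∀ s ≤ t, ∀ i, (Z s ω).2 i = v i s) ∧
          ((∀ i < j, (Z (t + 1) ω).2 i = v i (t + 1)) ∧ (Z (t + 1) ω).2 j = w)} := by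
      ext ω
      simp only [Set.mem_ofPred_eq]
      constructor
      · rintro ⟨⟨ha, hb⟩, hc⟩
        exact ⟨fun s hs i => ha i s hs, hb, hc⟩
      · rintro ⟨ha, hb, hc⟩
        exact ⟨⟨fun i s hs => ha s hs i, hb⟩, hc⟩
    have e2 : {ω | (∀ i : Fin k, ∀ s ≤ t, (Z s ω).2 i = v i s) ∧
              (∀ i < j, (Z (t + 1) ω).2 i = v i (t + 1))} =
        {ω | (∀ s ≤ t, ∀ i, (Z s ω).2 i = v i s) ∧
          (∀ i < j, (Z (t + 1) ω).2 i = v i (t + 1))} := by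
      ext ω
      simp only [Set.mem_ofPred_eq]
      constructor
      · rintro ⟨ha, hb⟩
        exact ⟨fun s hs i => ha i s hs, hb⟩
      · rintro ⟨ha, hb⟩
        exact ⟨fun i s hs => ha s hs i, hb⟩
    rw [e1, e2, h1, h2, Finset.sum_mul]
    refine Finset.sum_congr rfl fun z _ => ?_
    by_cases hz : chainWeight (D.init s0) D.P (fun s z => ∀ i, z.2 i = v i s) t z = 0
    · rw [hz, zero_mul, zero_mul, zero_mul]
    · obtain ⟨hz1, hz2⟩ := D.weight_valid s0 _ t z hz
      have hm := D.markov_step hk z hz2 j (fun i => v i (t + 1)) w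
      simp only [hz1] at hm
      rw [mul_assoc]
      congr 1

end AvoidData

/-- The concrete data: `m₁` columns of size two and `m₂` columns of size three. -/
lemma exists_avoidData (n k m₁ m₂ : ℕ) (hk : 0 < k) (h1 : k ≤ m₁) (h2 : k ≤ m₂)
    (hn : n = 2 * m₁ + 3 * m₂) : Nonempty (AvoidData n k (ZMod m₁ ⊕ ZMod m₂)) := by
  haveI : NeZero m₁ := ⟨by omega⟩
  haveI : NeZero m₂ := ⟨by omega⟩
  have hc : Fintype.card (Fin n) = Fintype.card (ZMod m₁ × ZMod 2 ⊕ ZMod m₂ × ZMod 3) := by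
    simp [ZMod.card, hn]; ring
  let e := Fintype.equivOfCardEq hc
  let c : (ZMod m₁ × ZMod 2 ⊕ ZMod m₂ × ZMod 3) → ZMod m₁ ⊕ ZMod m₂ := Sum.map Prod.fst Prod.fst
  let sg : Equiv.Perm (ZMod m₁ × ZMod 2 ⊕ ZMod m₂ × ZMod 3) :=
    Equiv.sumCongr (Equiv.prodCongr (Equiv.refl _) (Equiv.addRight 1))
      (Equiv.prodCongr (Equiv.refl _) (Equiv.addRight 1))
  let ta : Fin k → Equiv.Perm (ZMod m₁ ⊕ ZMod m₂) := fun j =>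
    Equiv.sumCongr (Equiv.addRight (j.1 : ZMod m₁)) (Equiv.addRight (j.1 : ZMod m₂))
  let li : Fin k → Equiv.Perm (ZMod m₁ × ZMod 2 ⊕ ZMod m₂ × ZMod 3) := fun j =>
    Equiv.sumCongr (Equiv.prodCongr (Equiv.addRight (j.1 : ZMod m₁)) (Equiv.refl _))
      (Equiv.prodCongr (Equiv.addRight (j.1 : ZMod m₂)) (Equiv.refl _))
  have hinj : ∀ (m : ℕ) (i j : Fin k), k ≤ m → ((i.1 : ℕ) : ZMod m) = (j.1 : ℕ) → i = j := by
    intro m i j hm hij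
    rw [ZMod.natCast_eq_natCast_iff'] at hij
    rw [Nat.mod_eq_of_lt (by omega), Nat.mod_eq_of_lt (by omega)] at hij
    exact Fin.ext hij
  refine ⟨⟨fun v => c (e v), ?_, e.trans (sg.trans e.symm), ?_, ?_, ta,
    fun j => e.trans ((li j).trans e.symm), ?_, ?_⟩⟩
  · rintro (a | a)
    · exact ⟨e.symm (Sum.inl (a, 0)), by simp [c]⟩
    · exact ⟨e.symm (Sum.inr (a, 0)), by simp [c]⟩
  · intro v
    simp only [Equiv.trans_apply, Equiv.apply_symm_apply]
    rcases e v with ⟨a, b⟩ | ⟨a, b⟩ <;> simp [c, sg]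
  · intro v hv
    simp only [Equiv.trans_apply] at hv
    rw [Equiv.symm_apply_eq] at hv
    generalize e v = y at hv
    rcases y with ⟨a, b⟩ | ⟨a, b⟩
    · simp [sg] at hv
    · simp [sg] at hv
  · intro j v
    simp only [Equiv.trans_apply, Equiv.apply_symm_apply]
    rcases e v with ⟨a, b⟩ | ⟨a, b⟩ <;> simp [c, li, ta]
  · rintro i j (s | s) hij he
    · simp only [ta, Equiv.sumCongr_apply, Sum.map_inl, Sum.inl.injEq, Equiv.coe_addRight,
        add_right_inj] at he
      exact hij (hinj m₁ i j h1 he)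
    · simp only [ta, Equiv.sumCongr_apply, Sum.map_inr, Sum.inr.injEq, Equiv.coe_addRight,
        add_right_inj] at he
      exact hij (hinj m₂ i j h2 he)

lemma coupling_of_le (n k : ℕ) (hk : 1 ≤ k) (hn : 5 * k + 3 ≤ n) :
    MarkovianAvoidanceCouplingLoopless n k := by
  obtain ⟨m₁, m₂, h1, h2, h3⟩ : ∃ m₁ m₂, k ≤ m₁ ∧ k ≤ m₂ ∧ n = 2 * m₁ + 3 * m₂ := by
    rcases Nat.even_or_odd' (n - 3 * k) with ⟨m, hm | hm⟩
    · exact ⟨m, k, by omega, le_rfl, by omega⟩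
    · exact ⟨m - 1, k + 1, by omega, by omega, by omega⟩
  haveI : NeZero m₁ := ⟨by omega⟩
  haveI : NeZero m₂ := ⟨by omega⟩
  obtain ⟨D⟩ := exists_avoidData n k m₁ m₂ hk h1 h2 h3
  exact D.coupling hk (Sum.inl 0)

/-- For all `n ≥ 2` and `k ≥ 1` with `k ≤ n / (56 log₂ n)`, there is a
Markovian avoidance coupling of `k` walkers on the loopless complete graph
`K_n`. -/
theorem markovian_avoidance_coupling_loopless_general (n k : ℕ)
    (hn : 2 ≤ n) (hk : 1 ≤ k)
    (hkn : (k : ℝ) ≤ (n : ℝ) / (56 * Real.logb 2 (n : ℝ))) :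
    MarkovianAvoidanceCouplingLoopless n k := by
  have hlog : (1 : ℝ) ≤ Real.logb 2 (n : ℝ) := by
    rw [Real.le_logb_iff_rpow_le (by norm_num) (by positivity)]
    simpa using (by exact_mod_cast hn : (2 : ℝ) ≤ n)
  have h56 : (k : ℝ) * 56 ≤ n := by
    rw [le_div_iff₀ (by positivity)] at hkn
    nlinarith [(Nat.cast_nonneg k : (0 : ℝ) ≤ k)]
  have : k * 56 ≤ n := by exact_mod_cast h56
  exact coupling_of_le n k hk (by omega)
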